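/- Let F be a field and k ≤ n positive integers. The set GS_{n,k} of generalized Garsia–Stanton monomials descends to an F-vector space basis of the quotient S_{n,k} = F[x_1,…,x_n]/J_{n,k}. -/

import Mathlib

open scoped Classical
open MvPolynomial

noncomputable section

namespace OSPHecke

/-- Stirling numbers of the second kind. -/
def stirling : ℕ → ℕ → ℕ
  | 0, 0 => 1
  | 0, _ + 1 => 0
  | _ + 1, 0 => 0
  | n + 1, k + 1 => stirling n k + (k + 1) * stirling n (k + 1)

/-- The `q`-analogue `[k]_q = 1 + q + ⋯ + q^{k-1}` as a polynomial in `q` over `ℕ`. -/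
def qnat (k : ℕ) : Polynomial ℕ := ∑ t ∈ Finset.range k, Polynomial.X ^ t

/-- The `q`-factorial `[k]!_q`. -/
def qfact : ℕ → Polynomial ℕ
  | 0 => 1
  | k + 1 => qnat (k + 1) * qfact k

/-- The `q`-Stirling numbers `Stir_q(n,k)`, defined by
`Stir_q(n,k) = Stir_q(n-1,k-1) + [k]_q · Stir_q(n-1,k)` and `Stir_q(0,k) = δ_{0,k}`. -/
def qstirling : ℕ → ℕ → Polynomial ℕ
  | 0, 0 => 1
  | 0, _ + 1 => 0
  | _ + 1, 0 => 0
  | n + 1, k + 1 => qstirling n k + qnat (k + 1) * qstirling n (k + 1)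

variable (F : Type*) [Field F]

/-- The complete homogeneous symmetric polynomial of degree `d` in the first `m`
variables `x_1, …, x_m` of `F[x_1, …, x_n]` (variables are 0-indexed). -/
def hpoly (n d m : ℕ) : MvPolynomial (Fin n) F :=
  ∑ s ∈ Finset.univ.filter (fun s : Sym (Fin n) d => ∀ j ∈ s.1, (j : ℕ) < m),
    (s.1.map MvPolynomial.X).prod

/-- The ideal `J_{n,k}` generated by `h_k(x_1), h_k(x_1,x_2), …, h_k(x_1,…,x_n)` and
`e_n(x_n), e_{n-1}(x_n), …, e_{n-k+1}(x_n)`. -/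
def Jideal (n k : ℕ) : Ideal (MvPolynomial (Fin n) F) :=
  Ideal.span ({f | ∃ m, 1 ≤ m ∧ m ≤ n ∧ f = hpoly F n k m} ∪
    {f | ∃ d, n - k < d ∧ d ≤ n ∧ f = MvPolynomial.esymm (Fin n) F d})

/-- The neglex order on exponent vectors: `a < b` iff there is a position `j` with
`a j < b j` and `a l = b l` for all `l > j`. -/
def NeglexLt {n : ℕ} (a b : Fin n → ℕ) : Prop :=
  ∃ j : Fin n, a j < b j ∧ ∀ l, j < l → a l = b l

/-- The value `w(t+1)` of a permutation at the 1-based position `t+1`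
(0-based position `t`); extended by `0` outside the range. -/
def permVal {n : ℕ} (w : Equiv.Perm (Fin n)) (t : ℕ) : ℕ :=
  if h : t < n then (w ⟨t, h⟩ : ℕ) else 0

/-- The descent set of a permutation, recorded 1-based:
`Des(w) = {j ∈ [n-1] : w(j) > w(j+1)}`. -/
def permDes {n : ℕ} (w : Equiv.Perm (Fin n)) : Finset ℕ :=
  (Finset.Ico 1 n).filter fun j => permVal w j < permVal w (j - 1)

/-- The inversion number (= Coxeter length) of a permutation. -/
def invCount {n : ℕ} (w : Equiv.Perm (Fin n)) : ℕ :=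
  ((Finset.univ : Finset (Fin n × Fin n)).filter fun p => p.1 < p.2 ∧ w p.2 < w p.1).card

/-- The descent set (1-based) of a sequence `i = (i_1, i_2, …)`, given 0-based as
`i : ℕ → ℕ`: `Des(i) = {j ∈ [n-1] : i_j > i_{j+1}}`. -/
def seqDes (n : ℕ) (i : ℕ → ℕ) : Finset ℕ :=
  (Finset.Ico 1 n).filter fun j => i j < i (j - 1)

/-- `α` is a composition of `n`. -/
def IsComposition (n : ℕ) (α : List ℕ) : Prop := α.sum = n ∧ ∀ a ∈ α, 0 < a

/-- The descent set of a composition: the partial sums `α_1, α_1+α_2, …`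
excluding the total sum. -/
def desComp (α : List ℕ) : Finset ℕ :=
  ((Finset.range α.length).filter fun t => 0 < t).image fun t => (α.take t).sum

/-- The variable `x_{t+1}` (0-based index `t`), extended by `0` out of range. -/
def Xv (n : ℕ) (t : ℕ) : MvPolynomial (Fin n) F :=
  if h : t < n then MvPolynomial.X ⟨t, h⟩ else 0

/-- The adjacent transposition exchanging the 0-based indices `t` and `t+1`. -/
def adjSwap (n t : ℕ) : Equiv.Perm (Fin n) :=
  if h : t + 1 < n then Equiv.swap ⟨t, Nat.lt_of_succ_lt h⟩ ⟨t + 1, h⟩ else 1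

/-- `PibarRel F n t f g` says that `g = π̄_t(f)`, where (0-based indices `t`, `t+1`)
`π̄_t(f) = (x_{t+1}·(f - s_t(f)))/(x_t - x_{t+1}) = π_t(f) - f`; since `F[x]` is an
integral domain such a `g` is unique when it exists (and it always exists). -/
def PibarRel (n t : ℕ) (f g : MvPolynomial (Fin n) F) : Prop :=
  (Xv F n t - Xv F n (t + 1)) * g =
    Xv F n (t + 1) * (f - MvPolynomial.rename (⇑(adjSwap n t)) f)

/-- The permutation associated to a word of (0-based) adjacent transposition indices. -/
def wordPerm (n : ℕ) (L : List ℕ) : Equiv.Perm (Fin n) := (L.map (adjSwap n)).prod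

/-- `L` is a reduced word for `w`. -/
def IsReducedWord (n : ℕ) (L : List ℕ) (w : Equiv.Perm (Fin n)) : Prop :=
  (∀ t ∈ L, t + 1 < n) ∧ wordPerm n L = w ∧
    ∀ L' : List ℕ, (∀ t ∈ L', t + 1 < n) → wordPerm n L' = w → L.length ≤ L'.length

/-- `g` is a chain of successive applications of the operators `π̄` along the word `L`,
applied right-to-left (so `g (t+1) = π̄_{L.reverse[t]} (g t)`). -/
def PibarChain (n : ℕ) (L : List ℕ) (g : ℕ → MvPolynomial (Fin n) F) : Prop :=
  ∀ t, t < L.length → PibarRel F n (L.reverse.getD t 0) (g t) (g (t + 1))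

/-- `p = π̄_w(f)`, computed along some reduced word for `w`. -/
def IsPibarApplied (n : ℕ) (w : Equiv.Perm (Fin n)) (f p : MvPolynomial (Fin n) F) : Prop :=
  ∃ (L : List ℕ) (g : ℕ → MvPolynomial (Fin n) F),
    IsReducedWord n L w ∧ g 0 = f ∧ PibarChain F n L g ∧ g L.length = p

/-- The monomial `x_{α,i} = (∏_{j ∈ Des(α)} x_1⋯x_j) · x_1^{i_1}⋯x_n^{i_n}`. -/
def xAI (n : ℕ) (α : List ℕ) (i : ℕ → ℕ) : MvPolynomial (Fin n) F :=
  (∏ j ∈ desComp α, ∏ t ∈ Finset.range j, Xv F n t) *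
    ∏ t ∈ Finset.range n, Xv F n t ^ i t

/-- The defining conditions for the index set `A_{n,k}`: `α` is a composition of `n`
with `α_1 > n-k`, and `k - ℓ(α) ≥ i_1 ≥ ⋯ ≥ i_{n-k} ≥ 0 = i_{n-k+1} = ⋯ = i_n`
(the sequence `i` is 0-indexed: `i t` is the paper's `i_{t+1}`). -/
def Acond (n k : ℕ) (α : List ℕ) (i : ℕ → ℕ) : Prop :=
  IsComposition n α ∧ n - k < α.headI ∧ i 0 + α.length ≤ k ∧
    (∀ a b, a ≤ b → b < n - k → i b ≤ i a) ∧ ∀ t, n - k ≤ t → i t = 0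

/-- The exponent vector of the generalized Garsia–Stanton monomial `gs_{w,i}`:
the variable `x_{w(t)}` has exponent `#{d ∈ Des(w) : d ≥ t} + i_t` (1-based `t`). -/
def gsExp {n : ℕ} (w : Equiv.Perm (Fin n)) (i : ℕ → ℕ) : Fin n → ℕ := fun m =>
  ((permDes w).filter fun r => (w.symm m : ℕ) + 1 ≤ r).card + i (w.symm m : ℕ)

/-- The generalized Garsia–Stanton monomial `gs_{w,i}`. -/
def gsMono (n : ℕ) (w : Equiv.Perm (Fin n)) (i : ℕ → ℕ) : MvPolynomial (Fin n) F :=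
  ∏ m : Fin n, MvPolynomial.X m ^ gsExp w i m

/-- The condition `k - des(w) > i_1 ≥ ⋯ ≥ i_{n-k} ≥ 0 = i_{n-k+1} = ⋯ = i_n` defining
membership of `gs_{w,i}` in `GS_{n,k}`. -/
def GScond (n k : ℕ) (w : Equiv.Perm (Fin n)) (i : ℕ → ℕ) : Prop :=
  i 0 + (permDes w).card < k ∧ (∀ a b, a ≤ b → b < n - k → i b ≤ i a) ∧
    ∀ t, n - k ≤ t → i t = 0

/-- An ordered set partition of `[n]` with `k` blocks: a `k`-tuple of nonempty,
pairwise disjoint subsets of `Fin n` covering `Fin n`. -/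
def OSP (n k : ℕ) : Type :=
  {B : Fin k → Finset (Fin n) // (∀ j, (B j).Nonempty) ∧
    (∀ j l, j ≠ l → ∀ x, x ∈ B j → x ∉ B l) ∧ ∀ x, ∃ j, x ∈ B j}

/-- Relabelling the letters of an ordered set partition by a permutation. -/
def ospMap {n k : ℕ} (e : Equiv.Perm (Fin n)) (σ : OSP n k) : OSP n k :=
  ⟨fun j => (σ.1 j).image e, by
    obtain ⟨h1, h2, h3⟩ := σ.2
    refine ⟨fun j => (h1 j).image e, fun j l hjl x hx hx' => ?_, fun x => ?_⟩
    · rcases Finset.mem_image.1 hx with ⟨y, hy, hey⟩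
      rcases Finset.mem_image.1 hx' with ⟨y', hy', hey'⟩
      have : y = y' := e.injective (hey.trans hey'.symm)
      exact h2 j l hjl y hy (this ▸ hy')
    · rcases h3 (e.symm x) with ⟨j, hj⟩
      exact ⟨j, Finset.mem_image.2 ⟨e.symm x, hj, e.apply_symm_apply x⟩⟩⟩

/-- `b` lies in a block strictly to the left of the block of `a`. -/
def leftOf {n k : ℕ} (σ : OSP n k) (a b : Fin n) : Prop :=
  ∃ p q : Fin k, p < q ∧ b ∈ σ.1 p ∧ a ∈ σ.1 q

/-- `a` and `b` lie in the same block. -/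
def sameBlock {n k : ℕ} (σ : OSP n k) (a b : Fin n) : Prop :=
  ∃ p : Fin k, a ∈ σ.1 p ∧ b ∈ σ.1 p

/-- The value of the 0-Hecke generator `π` (for the pair of letters `a = i`,
`b = i+1`) on a basis element of `F[OP_{n,k}]`. -/
def heckeImg {n k : ℕ} (a b : Fin n) (σ : OSP n k) : OSP n k →₀ F :=
  if leftOf σ a b then 0
  else if sameBlock σ a b then Finsupp.single σ 1
  else Finsupp.single σ 1 + Finsupp.single (ospMap (Equiv.swap a b) σ) 1

/-- The 0-Hecke operator `π` on `F[OP_{n,k}]` for the pair of letters `a = i`, `b = i+1`. -/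
def heckeOp {n k : ℕ} (a b : Fin n) (f : OSP n k →₀ F) : OSP n k →₀ F :=
  f.sum fun σ c => c • heckeImg F a b σ

/-- The value of the 0-Hecke generator `π̄ = π - 1` on a basis element of `F[OP_{n,k}]`. -/
def pibarImg {n k : ℕ} (a b : Fin n) (σ : OSP n k) : OSP n k →₀ F :=
  if leftOf σ a b then -Finsupp.single σ 1
  else if sameBlock σ a b then 0
  else Finsupp.single (ospMap (Equiv.swap a b) σ) 1

/-- The 0-Hecke operator `π̄ = π - 1` on `F[OP_{n,k}]`. -/
def pibarOp {n k : ℕ} (a b : Fin n) (f : OSP n k →₀ F) : OSP n k →₀ F :=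
  f.sum fun σ c => c • pibarImg F a b σ

/-- `IsShuffle l₁ l₂ l` : `l` is an interleaving of `l₁` and `l₂` preserving the
relative order of the entries of each. -/
inductive IsShuffle : List ℕ → List ℕ → List ℕ → Prop
  | nil : IsShuffle [] [] []
  | left {a l₁ l₂ l} : IsShuffle l₁ l₂ l → IsShuffle (a :: l₁) l₂ (a :: l)
  | right {a l₁ l₂ l} : IsShuffle l₁ l₂ l → IsShuffle l₁ (a :: l₂) (a :: l)

/-- An `(n,k)`-staircase: a shuffle of `(k-1, k-2, …, 1, 0)` with `n-k` copies of `k-1`. -/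
def IsStaircase (n k : ℕ) (s : Fin n → ℕ) : Prop :=
  ∃ L : List ℕ, IsShuffle ((List.range k).reverse) (List.replicate (n - k) (k - 1)) L ∧
    ∀ j : Fin n, s j = L.getD (j : ℕ) 0

/-- `B` is an ordered set partition of `[n]` (`n = α.sum`) of shape `α`. -/
def IsOSPShape (α : List ℕ) (B : Fin α.length → Finset (Fin α.sum)) : Prop :=
  (∀ j, (B j).card = α.get j) ∧
    (∀ j l, j ≠ l → ∀ x, x ∈ B j → x ∉ B l) ∧ ∀ x, ∃ j, x ∈ B j

/-- The ordered set partition `({1,…,α_1} | {α_1+1,…,α_1+α_2} | ⋯)` of shape `α`,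
as a tuple of blocks. -/
def sigma0 (α : List ℕ) : Fin α.length → Finset (Fin α.sum) := fun j =>
  Finset.univ.filter fun x =>
    (α.take (j : ℕ)).sum ≤ (x : ℕ) ∧ (x : ℕ) < (α.take ((j : ℕ) + 1)).sum

section Shape

variable {n ℓ : ℕ}

/-- `b` lies in a block strictly to the left of the block of `a` (tuples of blocks). -/
def blkLeft (B : Fin ℓ → Finset (Fin n)) (a b : Fin n) : Prop :=
  ∃ p q : Fin ℓ, p < q ∧ b ∈ B p ∧ a ∈ B q

/-- `a` and `b` lie in the same block (tuples of blocks). -/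
def blkSame (B : Fin ℓ → Finset (Fin n)) (a b : Fin n) : Prop :=
  ∃ p : Fin ℓ, a ∈ B p ∧ b ∈ B p

/-- The value of the 0-Hecke generator `π` (for letters `a = i`, `b = i+1`) on a basis
element of the free module on tuples of blocks. -/
def shapeImg (a b : Fin n) (B : Fin ℓ → Finset (Fin n)) :
    (Fin ℓ → Finset (Fin n)) →₀ F :=
  if blkLeft B a b then 0
  else if blkSame B a b then Finsupp.single B 1
  else Finsupp.single B 1 + Finsupp.single (fun j => (B j).image (Equiv.swap a b)) 1

/-- The 0-Hecke operator `π` on the free module on tuples of blocks. -/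
def shapeOp (a b : Fin n) (f : (Fin ℓ → Finset (Fin n)) →₀ F) :
    (Fin ℓ → Finset (Fin n)) →₀ F :=
  f.sum fun B c => c • shapeImg F a b B

end Shape

/-- A `k`-tuple of blocks is an ordered set partition of `[n]` with `k` blocks. -/
def IsOSPFun {n k : ℕ} (B : Fin k → Finset (Fin n)) : Prop :=
  (∀ j, (B j).Nonempty) ∧ (∀ j l, j ≠ l → ∀ x, x ∈ B j → x ∉ B l) ∧ ∀ x, ∃ j, x ∈ B j

/-- The `t`-th block (0-based) of a tuple of blocks, extended by `∅` out of range. -/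
def blockExt {n k : ℕ} (B : Fin k → Finset (Fin n)) (t : ℕ) : Finset (Fin n) :=
  if h : t < k then B ⟨t, h⟩ else ∅

/-- The word (values in `{1, …, n}`) obtained by listing the elements of each block in
increasing order, reading the blocks from left to right. -/
def ospWord {n k : ℕ} (B : Fin k → Finset (Fin n)) : List ℕ :=
  (List.finRange k).flatMap fun j => ((B j).sort (· ≤ ·)).map fun x => (x : ℕ) + 1

/-- The major index of a word: the sum of the (1-based) positions `j` with
`L_j > L_{j+1}`. -/
def wordMaj (L : List ℕ) : ℕ :=
  ∑ j ∈ Finset.range (L.length - 1), if L.getD (j + 1) 0 < L.getD j 0 then j + 1 else 0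

/-- The major index of an ordered set partition `σ = (B_1 | ⋯ | B_k)`:
`maj(σ) = maj(w) + ∑_{i : max(B_i) < min(B_{i+1})} (α_1 + ⋯ + α_i - i)`. -/
def ospMaj {n k : ℕ} (B : Fin k → Finset (Fin n)) : ℕ :=
  wordMaj (ospWord B) +
    ∑ t ∈ Finset.range (k - 1),
      if ∀ a ∈ blockExt B t, ∀ b ∈ blockExt B (t + 1), a < b then
        (∑ j ∈ Finset.range (t + 1), (blockExt B j).card) - (t + 1)
      else 0

/-- The complete homogeneous symmetric function of degree `d` evaluated at field
elements `v_1, …, v_n`. -/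
def hval {n : ℕ} (v : Fin n → F) (d : ℕ) : F :=
  ∑ s ∈ (Finset.univ : Finset (Sym (Fin n) d)), (s.1.map v).prod

/-- The elementary symmetric function of degree `d` evaluated at field elements
`v_1, …, v_n` (it vanishes for `d > n`). -/
def esymval {n : ℕ} (v : Fin n → F) (d : ℕ) : F :=
  ∑ t ∈ Finset.powersetCard d Finset.univ, ∏ j ∈ t, v j

end OSPHecke

namespace OSPHecke

/-- The number of descents of `w` weakly to the right of the 0-based position `s`. -/
def desFrom {n : ℕ} (w : Equiv.Perm (Fin n)) (s : ℕ) : ℕ :=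
  ((permDes w).filter fun r => s + 1 ≤ r).card

lemma succ_mem_permDes {n : ℕ} (w : Equiv.Perm (Fin n)) {s : ℕ} (hs : s + 1 < n) :
    s + 1 ∈ permDes w ↔ w ⟨s + 1, hs⟩ < w ⟨s, Nat.lt_of_succ_lt hs⟩ := by
  unfold permDes
  rw [Finset.mem_filter]
  simp [permVal, hs, Nat.lt_of_succ_lt hs]

lemma mem_permDes_bounds {n : ℕ} {w : Equiv.Perm (Fin n)} {r : ℕ} (hr : r ∈ permDes w) :
    1 ≤ r ∧ r < n :=
  Finset.mem_Ico.1 (Finset.mem_filter.1 hr).1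

lemma desFrom_succ {n : ℕ} (w : Equiv.Perm (Fin n)) (s : ℕ) :
    desFrom w s = desFrom w (s + 1) + if s + 1 ∈ permDes w then 1 else 0 := by
  have h : (permDes w).filter (fun r => s + 1 ≤ r) =
      (permDes w).filter (fun r => s + 1 + 1 ≤ r) ∪ (permDes w).filter (fun r => r = s + 1) := by
    ext r
    simp only [Finset.mem_filter, Finset.mem_union]
    constructor
    · rintro ⟨h1, h2⟩
      by_cases h3 : r = s + 1
      · exact Or.inr ⟨h1, h3⟩
      · exact Or.inl ⟨h1, by omega⟩
    · rintro (⟨h1, h2⟩ | ⟨h1, h2⟩)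
      · exact ⟨h1, by omega⟩
      · exact ⟨h1, by omega⟩
  unfold desFrom
  rw [h, Finset.card_union_of_disjoint, Finset.filter_eq']
  · split_ifs <;> simp
  · rw [Finset.disjoint_left]
    intro r h1 h2
    have h1 := (Finset.mem_filter.1 h1).2
    have h2 := (Finset.mem_filter.1 h2).2
    omega

lemma desFrom_zero {n : ℕ} (w : Equiv.Perm (Fin n)) : desFrom w 0 = (permDes w).card := by
  unfold desFrom
  rw [Finset.filter_true_of_mem]
  intro r hr
  simpa using (mem_permDes_bounds hr).1

lemma desFrom_eq_zero {n : ℕ} (w : Equiv.Perm (Fin n)) {s : ℕ} (hs : n ≤ s + 1) :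
    desFrom w s = 0 := by
  unfold desFrom
  rw [Finset.card_eq_zero, Finset.filter_eq_empty_iff]
  intro r hr
  have := (mem_permDes_bounds hr).2
  omega

lemma desFrom_antitone {n : ℕ} (w : Equiv.Perm (Fin n)) : Antitone (desFrom w) :=
  antitone_nat_of_succ_le fun s => by rw [desFrom_succ w s]; omega

lemma lt_of_desFrom_eq {n : ℕ} (w : Equiv.Perm (Fin n)) {s t : ℕ} (hst : s < t) (ht : t < n)
    (h : desFrom w s = desFrom w t) : w ⟨s, hst.trans ht⟩ < w ⟨t, ht⟩ := by
  induction t, hst using Nat.le_induction with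
  | base =>
    rw [desFrom_succ] at h
    have h1 : s + 1 ∉ permDes w := by
      intro h1
      simp [h1] at h
    rw [succ_mem_permDes w ht, not_lt] at h1
    refine lt_of_le_of_ne h1 fun h2 => ?_
    have := w.injective h2
    simp at this
  | succ t hst ih =>
    have h1 : desFrom w t ≤ desFrom w s := desFrom_antitone w (by omega)
    have h2 := desFrom_succ w t
    have h3 : t + 1 ∉ permDes w := by
      intro h3
      simp only [h3, if_true] at h2
      omega
    simp only [h3, if_false] at h2
    refine (ih (by omega) (by omega)).trans ?_
    rw [succ_mem_permDes w ht, not_lt] at h3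
    refine lt_of_le_of_ne h3 fun h4 => ?_
    have := w.injective h4
    simp at this

/-- The permutation listing the indices by decreasing exponent, ties being broken by
increasing index. -/
def sortPerm {n : ℕ} (a : Fin n → ℕ) : Equiv.Perm (Fin n) :=
  Tuple.sort fun j : Fin n => ((j : ℕ) : ℤ) - n * a j

lemma sortPerm_spec {n : ℕ} (a : Fin n → ℕ) {s t : Fin n} (hst : s < t) :
    a (sortPerm a t) < a (sortPerm a s) ∨
      a (sortPerm a t) = a (sortPerm a s) ∧ sortPerm a s < sortPerm a t := by
  have h := Tuple.monotone_sort (fun j : Fin n => ((j : ℕ) : ℤ) - n * a j) hst.le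
  have hne : sortPerm a s ≠ sortPerm a t := fun h => hst.ne ((sortPerm a).injective h)
  change ((sortPerm a s : ℕ) : ℤ) - n * a (sortPerm a s) ≤
    ((sortPerm a t : ℕ) : ℤ) - n * a (sortPerm a t) at h
  generalize sortPerm a s = p at *
  generalize sortPerm a t = q at *
  have hp := p.2
  have hq := q.2
  rcases lt_trichotomy (a q) (a p) with h1 | h1 | h1
  · exact Or.inl h1
  · refine Or.inr ⟨h1, lt_of_le_of_ne ?_ hne⟩
    rw [h1] at h
    rw [Fin.le_def]
    omega
  · exfalso
    have : (n : ℤ) * (a p + 1) ≤ n * a q :=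
      mul_le_mul_of_nonneg_left (by exact_mod_cast h1) (by positivity)
    have h2 : ((q : ℕ) : ℤ) < n := by exact_mod_cast hq
    have h3 : (0 : ℤ) ≤ ((p : ℕ) : ℤ) := by positivity
    linarith

/-- The exponents of `a` listed in weakly decreasing order, extended by zero. -/
def sortedExp {n : ℕ} (a : Fin n → ℕ) (s : ℕ) : ℕ :=
  if h : s < n then a (sortPerm a ⟨s, h⟩) else 0

lemma sortedExp_step {n : ℕ} (a : Fin n → ℕ) (s : ℕ) :
    desFrom (sortPerm a) s + sortedExp a (s + 1) ≤
      sortedExp a s + desFrom (sortPerm a) (s + 1) := by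
  by_cases hs : s + 1 < n
  · have h := sortPerm_spec a (s := ⟨s, Nat.lt_of_succ_lt hs⟩) (t := ⟨s + 1, hs⟩) (by simp)
    rw [desFrom_succ, sortedExp, sortedExp, dif_pos hs, dif_pos (Nat.lt_of_succ_lt hs)]
    have h1 := succ_mem_permDes (sortPerm a) hs
    split_ifs with h2
    · have h3 := h1.1 h2
      rcases h with h | h
      · omega
      · exact absurd h.2 h3.not_gt
    · rcases h with h | h <;> omega
  · rw [desFrom_eq_zero _ (by omega : n ≤ s + 1), sortedExp, dif_neg hs]
    omega

lemma desFrom_le_sortedExp {n : ℕ} (a : Fin n → ℕ) (s : ℕ) :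
    desFrom (sortPerm a) s ≤ sortedExp a s := by
  obtain ⟨m, hm⟩ : ∃ m, n ≤ s + m := ⟨n, by omega⟩
  induction m generalizing s with
  | zero => rw [desFrom_eq_zero _ (by omega)]; omega
  | succ m ih =>
    have h1 := ih (s + 1) (by omega)
    have h2 := sortedExp_step a s
    omega

/-- The residual sequence of `a`: the sorted exponents minus the descent contributions of the
sorting permutation. -/
def residual {n : ℕ} (a : Fin n → ℕ) (s : ℕ) : ℕ := sortedExp a s - desFrom (sortPerm a) s

lemma residual_antitone {n : ℕ} (a : Fin n → ℕ) : Antitone (residual a) :=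
  antitone_nat_of_succ_le fun s => by
    have h1 := sortedExp_step a s
    have h2 := desFrom_le_sortedExp a s
    have h3 := desFrom_le_sortedExp a (s + 1)
    unfold residual
    omega

lemma gsExp_sortPerm {n : ℕ} (a : Fin n → ℕ) : gsExp (sortPerm a) (residual a) = a := by
  funext m
  change desFrom (sortPerm a) _ + residual a _ = _
  rw [residual, Nat.add_sub_cancel' (desFrom_le_sortedExp a _), sortedExp,
    dif_pos (Fin.is_lt _)]
  simp

/-- An exponent vector with entries less than `k` either is the exponent vector of a generalized
Garsia–Stanton monomial, or contains a large set `T` of indices which still consists of the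
leading indices after lowering the exponents on `T` by one. -/
theorem exists_gsExp_or_exists_top {n k : ℕ} (hk : 1 ≤ k) (hkn : k ≤ n) (a : Fin n → ℕ)
    (ha : ∀ j, a j < k) :
    (∃ w i, GScond n k w i ∧ gsExp w i = a) ∨
      ∃ T : Finset (Fin n), n - k < T.card ∧ (∀ p ∈ T, 0 < a p) ∧
        ∀ p ∈ T, ∀ q ∉ T, a q + 1 < a p ∨ (a q + 1 = a p ∧ p < q) := by
  by_cases h0 : residual a (n - k) = 0
  · refine Or.inl ⟨sortPerm a, residual a, ⟨?_, ?_, ?_⟩, gsExp_sortPerm a⟩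
    · rw [← desFrom_zero, residual, Nat.sub_add_cancel (desFrom_le_sortedExp a _), sortedExp]
      split_ifs
      · exact ha _
      · omega
    · intro s t hst _
      exact residual_antitone a hst
    · intro t ht
      have := residual_antitone a ht
      omega
  · right
    have hn : residual a n = 0 := by
      rw [residual, sortedExp, dif_neg (lt_irrefl n)]
      simp
    have hex : ∃ d, residual a d = 0 := ⟨n, hn⟩
    set d := Nat.find hex with hd
    have hd0 : residual a d = 0 := Nat.find_spec hex
    have hdn : d ≤ n := Nat.find_min' hex hn
    have hlt : ∀ s, s < d → 0 < residual a s := fun s hs =>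
      Nat.pos_of_ne_zero (Nat.find_min hex hs)
    have hdk : n - k < d := by
      by_contra hcon
      have := residual_antitone a (not_lt.1 hcon)
      omega
    have hres : ∀ s : Fin n, residual a s + desFrom (sortPerm a) s = a (sortPerm a s) := by
      intro s
      rw [residual, Nat.sub_add_cancel (desFrom_le_sortedExp a _), sortedExp, dif_pos s.2]
    refine ⟨((Finset.univ : Finset (Fin n)).filter fun s : Fin n => (s : ℕ) < d).map
      (sortPerm a).toEmbedding, ?_, ?_, ?_⟩
    · rw [Finset.card_map, Fin.card_filter_val_lt, min_eq_right hdn]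
      exact hdk
    · intro p hp
      simp only [Finset.mem_map, Finset.mem_filter, Finset.mem_univ, true_and] at hp
      obtain ⟨s, hs, rfl⟩ := hp
      have h1 := hres s
      have h2 := hlt s hs
      simp only [Equiv.coe_toEmbedding]
      omega
    · intro p hp q hq
      simp only [Finset.mem_map, Finset.mem_filter, Finset.mem_univ, true_and] at hp
      obtain ⟨s, hs, rfl⟩ := hp
      obtain ⟨t, rfl⟩ := (sortPerm a).surjective q
      have ht : d ≤ t := by
        by_contra hcon
        apply hq
        simp only [Finset.mem_map, Finset.mem_filter, Finset.mem_univ, true_and]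
        exact ⟨t, not_le.1 hcon, rfl⟩
      have h1 := hres s
      have h2 := hres t
      have h3 := hlt s hs
      have h4 := residual_antitone a ht
      have h5 : desFrom (sortPerm a) t ≤ desFrom (sortPerm a) s :=
        desFrom_antitone _ (by omega)
      simp only [Equiv.coe_toEmbedding]
      by_cases h6 : a (sortPerm a t) + 1 < a (sortPerm a s)
      · exact Or.inl h6
      · refine Or.inr ⟨by omega, ?_⟩
        exact lt_of_desFrom_eq (sortPerm a) (s := s) (t := t) (by omega) t.2 (by omega)

/-- The complete homogeneous symmetric polynomial of degree `d` in the first `m` variables, over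
an arbitrary commutative ring. -/
def homogSum (R : Type*) [CommRing R] (n d m : ℕ) : MvPolynomial (Fin n) R :=
  ∑ a ∈ Finset.finsuppAntidiag (Finset.univ.filter fun j : Fin n => (j : ℕ) < m) d,
    monomial a 1

lemma hpoly_eq_homogSum (F : Type*) [Field F] (n d m : ℕ) : hpoly F n d m = homogSum F n d m := by
  unfold hpoly homogSum
  refine Finset.sum_bij' (fun s _ => Multiset.toFinsupp s.1)
    (fun a ha => (⟨Finsupp.toMultiset a, ?_⟩ : Sym (Fin n) d)) ?_ ?_ ?_ ?_ ?_
  · rw [Finset.mem_finsuppAntidiag] at ha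
    rw [Finsupp.card_toMultiset, ← ha.1, Finsupp.sum_of_support_subset _ ha.2 _ (by simp)]
    rfl
  · intro s hs
    rw [Finset.mem_filter] at hs
    rw [Finset.mem_finsuppAntidiag]
    have hsub : (Multiset.toFinsupp s.1).support ⊆
        Finset.univ.filter fun j : Fin n => (j : ℕ) < m := by
      intro j hj
      rw [Multiset.toFinsupp_support, Multiset.mem_toFinset] at hj
      simpa using hs.2 j hj
    refine ⟨?_, hsub⟩
    have h := Multiset.toFinsupp_sum_eq s.1
    rw [Finsupp.sum_of_support_subset _ hsub _ (by simp)] at h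
    exact h.trans s.2
  · intro a ha
    rw [Finset.mem_finsuppAntidiag] at ha
    refine Finset.mem_filter.2 ⟨Finset.mem_univ _, fun j hj => ?_⟩
    have := ha.2 ((Finsupp.mem_toMultiset _ _).1 hj)
    simpa using this
  · intro s hs
    apply Subtype.ext
    simp
  · intro a ha
    simp
  · intro s hs
    rw [monomial_eq, C_1, one_mul, Finsupp.prod, Multiset.toFinsupp_support,
      Finset.prod_multiset_map_count]
    simp

/-- The weight `Σ_j j · a_j` of an exponent vector. -/
def expWeight {n : ℕ} (a : Fin n →₀ ℕ) : ℕ := ∑ j : Fin n, (j : ℕ) * a j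

lemma expWeight_lt {n k : ℕ} {i : Fin n} {u : Fin n →₀ ℕ}
    (hu : u ∈ Finset.finsuppAntidiag (Finset.univ.filter fun j : Fin n => (j : ℕ) < i + 1) k)
    (hne : u ≠ Finsupp.single i k) : expWeight u < i * k := by
  rw [Finset.mem_finsuppAntidiag] at hu
  obtain ⟨h1, h2⟩ := hu
  have hsum : ∑ j, u j = k := by
    rw [← h1]
    symm
    apply Finset.sum_subset (Finset.subset_univ _)
    intro j _ hj
    by_contra hcon
    exact hj (h2 (Finsupp.mem_support_iff.2 hcon))
  have hle : ∀ j, u j ≠ 0 → j ≤ i := by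
    intro j hj
    have := h2 (Finsupp.mem_support_iff.2 hj)
    simp only [Finset.mem_filter, Finset.mem_univ, true_and] at this
    rw [Fin.le_def]
    omega
  obtain ⟨j, hj, hji⟩ : ∃ j, u j ≠ 0 ∧ j ≠ i := by
    by_contra! hcon
    apply hne
    have h3 : ∀ j, j ≠ i → u j = 0 := fun j hj => by
      by_contra h4
      exact hj (hcon j h4)
    rw [Finset.sum_eq_single i (fun j _ hj => h3 j hj) (by simp)] at hsum
    ext j
    by_cases hj : j = i
    · subst hj
      simpa using hsum
    · rw [h3 j hj, Finsupp.single_eq_of_ne hj]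
  rw [← hsum, Finset.mul_sum]
  unfold expWeight
  refine Finset.sum_lt_sum (fun l _ => ?_) ⟨j, Finset.mem_univ _, ?_⟩
  · by_cases hl : u l = 0
    · simp [hl]
    · exact Nat.mul_le_mul_right _ (hle l hl)
  · exact Nat.mul_lt_mul_of_pos_right (Fin.lt_def.1 (lt_of_le_of_ne (hle j hj) hji))
      (Nat.pos_of_ne_zero hj)

lemma sum_lt_sum_of_top {ι : Type*} (κ : ι → ℤ) {S T : Finset ι} (hcard : S.card = T.card)
    (hne : S ≠ T) (htop : ∀ p ∈ T, ∀ q ∉ T, κ q < κ p) : ∑ j ∈ S, κ j < ∑ j ∈ T, κ j := by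
  have hTS : (T \ S).Nonempty := by
    rw [Finset.sdiff_nonempty]
    exact fun h => hne (Finset.eq_of_subset_of_card_le h hcard.le).symm
  have hST : (S \ T).Nonempty := by
    rw [Finset.sdiff_nonempty]
    exact fun h => hne (Finset.eq_of_subset_of_card_le h hcard.ge)
  have hc : (S \ T).card = (T \ S).card := Finset.card_sdiff_comm hcard
  obtain ⟨p, hp, hmin⟩ := Finset.exists_min_image (T \ S) κ hTS
  have h1 : ∑ j ∈ S \ T, κ j < (S \ T).card • κ p := by
    rw [← Finset.sum_const]
    exact Finset.sum_lt_sum_of_nonempty hST fun q hq =>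
      htop p (Finset.mem_sdiff.1 hp).1 q (Finset.mem_sdiff.1 hq).2
  have h2 : (T \ S).card • κ p ≤ ∑ j ∈ T \ S, κ j := Finset.card_nsmul_le_sum _ _ _ hmin
  rw [hc] at h1
  exact Finset.sum_sdiff_lt_sum_sdiff.1 (h1.trans_le h2)

/-- The quadratic weight `Σ_j a_j (n a_j - j)` of an exponent vector. -/
def quadWeight {n : ℕ} (a : Fin n →₀ ℕ) : ℤ :=
  ∑ j : Fin n, (a j : ℤ) * (n * a j - (j : ℕ))

lemma quadWeight_nonneg {n : ℕ} (a : Fin n →₀ ℕ) : 0 ≤ quadWeight a := by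
  refine Finset.sum_nonneg fun j _ => ?_
  rcases Nat.eq_zero_or_pos (a j) with h | h
  · simp [h]
  · have h1 : ((j : ℕ) : ℤ) < n := by exact_mod_cast j.2
    have h2 : (1 : ℤ) ≤ a j := by exact_mod_cast h
    have h3 : (n : ℤ) * 1 ≤ n * a j := mul_le_mul_of_nonneg_left h2 (by positivity)
    exact mul_nonneg (by omega) (by linarith)

/-- The exponent vector of the squarefree monomial supported on `S`. -/
def indicatorExp {n : ℕ} (S : Finset (Fin n)) : Fin n →₀ ℕ := ∑ j ∈ S, Finsupp.single j 1

lemma indicatorExp_apply {n : ℕ} (S : Finset (Fin n)) (j : Fin n) :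
    indicatorExp S j = if j ∈ S then 1 else 0 := by
  simp [indicatorExp, Finsupp.finsetSum_apply, Finsupp.single_apply]

lemma degree_indicatorExp {n : ℕ} (S : Finset (Fin n)) : (indicatorExp S).degree = S.card := by
  simp [indicatorExp, map_sum]

lemma quadWeight_add_indicatorExp {n : ℕ} (b : Fin n →₀ ℕ) (S : Finset (Fin n)) :
    quadWeight (indicatorExp S + b) =
      quadWeight b + ∑ j ∈ S, ((n : ℤ) * (2 * b j + 1) - (j : ℕ)) := by
  rw [← Finset.sum_subset (Finset.subset_univ S) (f := fun j =>
    if j ∈ S then ((n : ℤ) * (2 * b j + 1) - (j : ℕ)) else 0) (by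
      intro j _ hj
      simp [hj]) |>.symm.trans (Finset.sum_congr rfl fun j hj => by rw [if_pos hj])]
  unfold quadWeight
  rw [← Finset.sum_add_distrib]
  refine Finset.sum_congr rfl fun j _ => ?_
  rw [Finsupp.add_apply, indicatorExp_apply]
  split_ifs
  · push_cast
    ring
  · simp

section Straightening

variable {R : Type*} [CommRing R] {n : ℕ}

lemma mem_of_totalDegree_lt {M : Submodule R (MvPolynomial (Fin n) R)} {D : ℕ}
    (hM : ∀ a : Fin n →₀ ℕ, a.degree < D → monomial a 1 ∈ M) {f : MvPolynomial (Fin n) R}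
    (hf : f.totalDegree < D) : f ∈ M := by
  rw [f.as_sum]
  refine Submodule.sum_mem _ fun a ha => ?_
  have h : a.degree < D := lt_of_le_of_lt (le_totalDegree ha) hf
  have h1 : monomial a (coeff a f) = coeff a f • (monomial a 1 : MvPolynomial (Fin n) R) := by
    rw [smul_monomial, smul_eq_mul, mul_one]
  rw [h1]
  exact M.smul_mem _ (hM a h)

/-- Reduction of one monomial by an element of an ideal whose leading form is a sum of
monomials. -/
lemma monomial_mem_of_relation {M : Submodule R (MvPolynomial (Fin n) R)}
    {I : Ideal (MvPolynomial (Fin n) R)} (hIM : ∀ f ∈ I, f ∈ M) {D d : ℕ}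
    (hM : ∀ a : Fin n →₀ ℕ, a.degree < D → monomial a 1 ∈ M) {ι : Type*} {S : Finset ι}
    {u : ι → Fin n →₀ ℕ} {p : MvPolynomial (Fin n) R} (hp : p.totalDegree < d)
    (hI : ∑ s ∈ S, monomial (u s) 1 + p ∈ I) {b : Fin n →₀ ℕ} (hb : d + b.degree = D) {s₀ : ι}
    (hs₀ : s₀ ∈ S) (hS : ∀ s ∈ S, s ≠ s₀ → monomial (u s + b) 1 ∈ M) :
    monomial (u s₀ + b) 1 ∈ M := by
  have h1 : monomial b 1 * (∑ s ∈ S, monomial (u s) 1 + p) ∈ M := hIM _ (I.mul_mem_left _ hI)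
  have h2 : monomial b 1 * p ∈ M := by
    refine mem_of_totalDegree_lt hM (lt_of_le_of_lt (totalDegree_mul _ _) ?_)
    have := totalDegree_monomial_le (R := R) b 1
    change _ ≤ b.degree at this
    omega
  have h3 : ∑ s ∈ S.erase s₀, monomial (u s + b) (1 : R) ∈ M :=
    Submodule.sum_mem _ fun s hs => hS s (Finset.mem_of_mem_erase hs) (Finset.ne_of_mem_erase hs)
  have h4 : monomial (u s₀ + b) 1 = monomial b 1 * (∑ s ∈ S, monomial (u s) 1 + p) -
      monomial b 1 * p - ∑ s ∈ S.erase s₀, monomial (u s + b) (1 : R) := by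
    rw [mul_add, add_sub_cancel_right, Finset.mul_sum, ← Finset.add_sum_erase _ _ hs₀]
    simp only [monomial_mul, one_mul, add_comm b, add_sub_cancel_right]
  rw [h4]
  exact M.sub_mem (M.sub_mem h1 h2) h3

variable {k : ℕ}

/-- An ideal whose leading forms include the generators of `J_{n,k}`. -/
structure HasLeadingForms (n k : ℕ) (I : Ideal (MvPolynomial (Fin n) R)) : Prop where
  homog : ∀ m, 1 ≤ m → m ≤ n → ∃ p : MvPolynomial (Fin n) R,
    p.totalDegree < k ∧ homogSum R n k m + p ∈ I
  elem : ∀ d, n - k < d → d ≤ n → ∃ p : MvPolynomial (Fin n) R,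
    p.totalDegree < d ∧ esymm (Fin n) R d + p ∈ I

/-- The span of the generalized Garsia–Stanton monomials. -/
def gsSpan (R : Type*) [CommRing R] (n k : ℕ) : Submodule R (MvPolynomial (Fin n) R) :=
  Submodule.span R (Set.range fun p : {p : Equiv.Perm (Fin n) × (ℕ → ℕ) // GScond n k p.1 p.2} =>
    monomial (Finsupp.equivFunOnFinite.symm (gsExp p.1.1 p.1.2)) 1)

lemma monomial_mem_of_exp_lt (hk : 1 ≤ k) (hkn : k ≤ n) {I : Ideal (MvPolynomial (Fin n) R)}
    (hI : HasLeadingForms n k I) {D : ℕ}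
    (hM : ∀ a : Fin n →₀ ℕ, a.degree < D → monomial a 1 ∈ gsSpan R n k ⊔ I.restrictScalars R)
    (a : Fin n →₀ ℕ) (haD : a.degree = D) (hak : ∀ j, a j < k) :
    monomial a 1 ∈ gsSpan R n k ⊔ I.restrictScalars R := by
  obtain ⟨N, hN⟩ : ∃ N : ℕ, (quadWeight a).toNat = N := ⟨_, rfl⟩
  induction N using Nat.strong_induction_on generalizing a with
  | _ N ih =>
  rcases exists_gsExp_or_exists_top hk hkn a hak with ⟨w, i, hwi, hexp⟩ | ⟨T, hT, hpos, htop⟩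
  · refine Submodule.mem_sup_left (Submodule.subset_span ⟨⟨(w, i), hwi⟩, ?_⟩)
    change monomial (Finsupp.equivFunOnFinite.symm (gsExp w i)) 1 = _
    rw [hexp, Finsupp.equivFunOnFinite_symm_coe]
  · obtain ⟨b, rfl⟩ : ∃ b, a = indicatorExp T + b := by
      refine ⟨a - indicatorExp T, (add_tsub_cancel_of_le fun j => ?_).symm⟩
      rw [indicatorExp_apply]
      split_ifs with h
      · exact hpos j h
      · exact Nat.zero_le _
    have hval : ∀ j, (indicatorExp T + b) j = (if j ∈ T then 1 else 0) + b j := fun j => by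
      rw [Finsupp.add_apply, indicatorExp_apply]
    have hTn : T.card ≤ n := by simpa using Finset.card_le_univ T
    obtain ⟨p, hp, hpI⟩ := hI.elem T.card hT hTn
    rw [esymm_eq_sum_monomial] at hpI
    refine monomial_mem_of_relation (fun f hf => Submodule.mem_sup_right hf) hM hp hpI
      (u := indicatorExp) ?_ (Finset.mem_powersetCard.2 ⟨Finset.subset_univ _, rfl⟩) ?_
    · rw [map_add, degree_indicatorExp] at haD
      exact haD
    · intro S hS hST
      have hScard := (Finset.mem_powersetCard.1 hS).2
      have hlt : quadWeight (indicatorExp S + b) < quadWeight (indicatorExp T + b) := by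
        rw [quadWeight_add_indicatorExp, quadWeight_add_indicatorExp, add_lt_add_iff_left]
        refine sum_lt_sum_of_top _ hScard hST fun p hp q hq => ?_
        have h := htop p hp q hq
        rw [hval, hval, if_pos hp, if_neg hq] at h
        have hp2 : ((p : ℕ) : ℤ) < n := by exact_mod_cast p.2
        rcases h with h | ⟨h, hpq⟩
        · have h1 : (b q : ℤ) + 1 ≤ b p := by
            have : b q + 1 ≤ b p := by omega
            exact_mod_cast this
          have h2 : (n : ℤ) * (b q + 1) ≤ n * b p :=
            mul_le_mul_of_nonneg_left h1 (by positivity)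
          nlinarith
        · have h1 : b q = b p := by omega
          have h2 : ((p : ℕ) : ℤ) < (q : ℕ) := by exact_mod_cast hpq
          rw [h1]
          linarith
      refine ih _ ?_ _ ?_ ?_ rfl
      · have := quadWeight_nonneg (indicatorExp S + b)
        omega
      · rw [← haD, map_add, map_add, degree_indicatorExp, degree_indicatorExp, hScard]
      · intro j
        have hj := hak j
        rw [hval] at hj
        rw [Finsupp.add_apply, indicatorExp_apply]
        by_cases hjT : j ∈ T
        · rw [if_pos hjT] at hj
          split_ifs <;> omega
        · rw [if_neg hjT] at hj
          obtain ⟨p, hpT⟩ : T.Nonempty := Finset.card_pos.1 (by omega)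
          have h := htop p hpT j hjT
          have hp := hak p
          rw [hval, hval, if_pos hpT, if_neg hjT] at h
          rw [hval, if_pos hpT] at hp
          split_ifs <;> omega

lemma monomial_mem_of_degree_eq (hk : 1 ≤ k) (hkn : k ≤ n) {I : Ideal (MvPolynomial (Fin n) R)}
    (hI : HasLeadingForms n k I) {D : ℕ}
    (hM : ∀ a : Fin n →₀ ℕ, a.degree < D → monomial a 1 ∈ gsSpan R n k ⊔ I.restrictScalars R)
    (a : Fin n →₀ ℕ) (haD : a.degree = D) :
    monomial a 1 ∈ gsSpan R n k ⊔ I.restrictScalars R := by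
  obtain ⟨N, hN⟩ : ∃ N : ℕ, expWeight a = N := ⟨_, rfl⟩
  induction N using Nat.strong_induction_on generalizing a with
  | _ N ih =>
  by_cases hak : ∀ j, a j < k
  · exact monomial_mem_of_exp_lt hk hkn hI hM a haD hak
  · push Not at hak
    obtain ⟨i, hi⟩ := hak
    obtain ⟨b, rfl⟩ : ∃ b, a = Finsupp.single i k + b :=
      ⟨a - Finsupp.single i k, (add_tsub_cancel_of_le (Finsupp.single_le_iff.2 hi)).symm⟩
    obtain ⟨p, hp, hpI⟩ := hI.homog (i + 1) (by omega) (by omega)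
    refine monomial_mem_of_relation (fun f hf => Submodule.mem_sup_right hf) hM hp hpI
      (u := id) (s₀ := Finsupp.single i k) ?_ ?_ ?_
    · rw [map_add, Finsupp.degree_single] at haD
      exact haD
    · rw [Finset.mem_finsuppAntidiag]
      refine ⟨?_, Finsupp.support_single_subset.trans (by simp)⟩
      rw [Finset.sum_eq_single i (fun j _ hj => Finsupp.single_eq_of_ne hj) (by simp)]
      simp
    · intro u hu hne
      have hadd : ∀ u v : Fin n →₀ ℕ, expWeight (u + v) = expWeight u + expWeight v := by
        intro u v
        simp [expWeight, mul_add, Finset.sum_add_distrib]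
      have hsingle : expWeight (Finsupp.single i k) = i * k := by
        unfold expWeight
        rw [Finset.sum_eq_single i (fun j _ hj => by rw [Finsupp.single_eq_of_ne hj, mul_zero])
          (by simp)]
        simp
      have hlt := expWeight_lt hu hne
      refine ih _ ?_ _ ?_ rfl
      · rw [← hN, hadd, hadd, hsingle]
        exact Nat.add_lt_add_right hlt _
      · rw [Finset.mem_finsuppAntidiag] at hu
        have hdeg : u.degree = k := by
          rw [← hu.1, Finsupp.degree_eq_sum]
          symm
          apply Finset.sum_subset (Finset.subset_univ _)
          intro j _ hj
          by_contra hcon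
          exact hj (hu.2 (Finsupp.mem_support_iff.2 hcon))
        rw [← haD, map_add, map_add, Finsupp.degree_single, id, hdeg]

/-- The generalized Garsia–Stanton monomials span modulo any ideal with the leading forms of
`J_{n,k}`. -/
theorem gsSpan_sup_eq_top (hk : 1 ≤ k) (hkn : k ≤ n) {I : Ideal (MvPolynomial (Fin n) R)}
    (hI : HasLeadingForms n k I) : gsSpan R n k ⊔ I.restrictScalars R = ⊤ := by
  have h : ∀ D, ∀ a : Fin n →₀ ℕ, a.degree = D →
      monomial a 1 ∈ gsSpan R n k ⊔ I.restrictScalars R := by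
    intro D
    induction D using Nat.strong_induction_on with
    | _ D ih =>
      exact monomial_mem_of_degree_eq hk hkn hI fun a ha => ih _ ha a rfl
  rw [eq_top_iff]
  intro f _
  exact mem_of_totalDegree_lt (fun a _ => h _ a rfl) (Nat.lt_succ_self _)

end Straightening

/-- The number of elements of `B` that are at most `t`. -/
def countLE (B : Finset ℕ) (t : ℕ) : ℕ := (B.filter fun r => r ≤ t).card

lemma countLE_succ (B : Finset ℕ) (t : ℕ) :
    countLE B (t + 1) = countLE B t + if t + 1 ∈ B then 1 else 0 := by
  have h : B.filter (fun r => r ≤ t + 1) =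
      B.filter (fun r => r ≤ t) ∪ B.filter (fun r => r = t + 1) := by
    ext r
    simp only [Finset.mem_filter, Finset.mem_union, ← and_or_left]
    exact and_congr_right fun _ => by omega
  unfold countLE
  rw [h, Finset.card_union_of_disjoint, Finset.filter_eq']
  · split_ifs <;> simp
  · rw [Finset.disjoint_left]
    intro r h1 h2
    have h1 := (Finset.mem_filter.1 h1).2
    have h2 := (Finset.mem_filter.1 h2).2
    omega

lemma countLE_mono (B : Finset ℕ) : Monotone (countLE B) :=
  monotone_nat_of_le_succ fun t => by rw [countLE_succ]; omega

lemma countLE_le_card (B : Finset ℕ) (t : ℕ) : countLE B t ≤ B.card := Finset.card_filter_le _ _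

lemma exists_countLE_eq (B : Finset ℕ) (hB : 0 ∉ B) (t v : ℕ) (hv : v ≤ countLE B t) :
    ∃ s ≤ t, countLE B s = v := by
  induction t with
  | zero =>
    have h0 : countLE B 0 = 0 := by
      unfold countLE
      rw [Finset.card_eq_zero, Finset.filter_eq_empty_iff]
      intro r hr h
      exact hB (Nat.le_zero.1 h ▸ hr)
    exact ⟨0, le_rfl, by omega⟩
  | succ t ih =>
    by_cases h : v ≤ countLE B t
    · obtain ⟨s, hs, hsv⟩ := ih h
      exact ⟨s, by omega, hsv⟩
    · refine ⟨t + 1, le_rfl, ?_⟩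
      rw [countLE_succ] at hv ⊢
      split_ifs at hv ⊢ <;> omega

/-- The separators attached to a set `S` of chosen ascents of a permutation of `[n]`. -/
def separators (n : ℕ) (S : Finset ℕ) : Finset ℕ := Finset.Ico 1 n \ S

/-- Pairs of a permutation and a set of `n - k` of its ascents. -/
abbrev AscentChoice (n k : ℕ) : Type :=
  Σ w : Equiv.Perm (Fin n),
    {S : Finset ℕ // S ∈ Finset.powersetCard (n - k) (Finset.Ico 1 n \ permDes w)}

lemma AscentChoice.subset {n k : ℕ} (p : AscentChoice n k) :
    p.2.1 ⊆ Finset.Ico 1 n \ permDes p.1 := (Finset.mem_powersetCard.1 p.2.2).1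

lemma AscentChoice.card_separators {n k : ℕ} (hk : 1 ≤ k) (hkn : k ≤ n) (p : AscentChoice n k) :
    (separators n p.2.1).card = k - 1 := by
  rw [separators, Finset.card_sdiff_of_subset (p.subset.trans Finset.sdiff_subset),
    (Finset.mem_powersetCard.1 p.2.2).2, Nat.card_Ico]
  omega

/-- The block function of the ordered set partition attached to a permutation with chosen
ascents. -/
def blockFun {n k : ℕ} (hk : 1 ≤ k) (hkn : k ≤ n) (p : AscentChoice n k) (j : Fin n) : Fin k :=
  ⟨countLE (separators n p.2.1) (p.1.symm j), by
    have := countLE_le_card (separators n p.2.1) (p.1.symm j)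
    rw [p.card_separators hk hkn] at this
    omega⟩

lemma blockFun_apply {n k : ℕ} (hk : 1 ≤ k) (hkn : k ≤ n) (p : AscentChoice n k) (t : Fin n) :
    (blockFun hk hkn p (p.1 t) : ℕ) = countLE (separators n p.2.1) t := by
  simp [blockFun]

lemma blockFun_surjective {n k : ℕ} (hk : 1 ≤ k) (hkn : k ≤ n) (p : AscentChoice n k) :
    Function.Surjective (blockFun hk hkn p) := by
  intro v
  have hlast : countLE (separators n p.2.1) (n - 1) = k - 1 := by
    rw [← p.card_separators hk hkn, countLE, Finset.filter_true_of_mem]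
    intro r hr
    have := Finset.mem_Ico.1 (Finset.mem_sdiff.1 hr).1
    omega
  obtain ⟨s, hs, hsv⟩ := exists_countLE_eq (separators n p.2.1) (by simp [separators]) (n - 1) v
    (by omega)
  refine ⟨p.1 ⟨s, by omega⟩, Fin.ext ?_⟩
  rw [blockFun_apply]
  exact hsv

lemma blockFun_strictMono {n k : ℕ} (hk : 1 ≤ k) (hkn : k ≤ n) (p : AscentChoice n k) :
    StrictMono ((fun j : Fin n => n * (blockFun hk hkn p j : ℕ) + (j : ℕ)) ∘ p.1) := by
  intro s t hst
  simp only [Function.comp_apply, blockFun_apply]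
  have hmono : Monotone fun t => desFrom p.1 t + countLE (separators n p.2.1) t := by
    refine monotone_nat_of_le_succ fun t => ?_
    rw [desFrom_succ, countLE_succ]
    have himp : t + 1 ∈ permDes p.1 → t + 1 ∈ separators n p.2.1 := fun h =>
      Finset.mem_sdiff.2 ⟨Finset.mem_Ico.2 (mem_permDes_bounds h), fun h2 =>
        (Finset.mem_sdiff.1 (p.subset h2)).2 h⟩
    by_cases h : t + 1 ∈ permDes p.1
    · rw [if_pos h, if_pos (himp h)]
      omega
    · rw [if_neg h]
      omega
  have h1 := hmono (Fin.le_def.1 hst.le)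
  have h2 := countLE_mono (separators n p.2.1) (Fin.le_def.1 hst.le)
  have h3 := desFrom_antitone p.1 (Fin.le_def.1 hst.le)
  simp only at h1
  rcases h2.eq_or_lt with h4 | h4
  · have h5 := lt_of_desFrom_eq p.1 (s := s) (t := t) hst t.2 (by omega)
    rw [h4]
    exact Nat.add_lt_add_left h5 _
  · have h5 := (p.1 s).2
    calc n * countLE (separators n p.2.1) s + (p.1 s : ℕ)
        < n * (countLE (separators n p.2.1) s + 1) := by rw [mul_add]; omega
      _ ≤ n * countLE (separators n p.2.1) t := Nat.mul_le_mul_left _ h4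
      _ ≤ _ := Nat.le_add_right _ _

lemma blockFun_injective {n k : ℕ} (hk : 1 ≤ k) (hkn : k ≤ n) :
    Function.Injective (blockFun (n := n) (k := k) hk hkn) := by
  intro p q hpq
  have hp := blockFun_strictMono hk hkn p
  have hq := blockFun_strictMono hk hkn q
  rw [← hpq] at hq
  have hinj : Function.Injective fun j : Fin n => n * (blockFun hk hkn p j : ℕ) + (j : ℕ) :=
    (Function.Injective.of_comp_iff' _ p.1.bijective).1 hp.injective
  have hw : p.1 = q.1 := by
    have := Tuple.unique_monotone hp.monotone hq.monotone
    ext j : 1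
    exact hinj (congrFun this j)
  have hc : ∀ t, t < n → countLE (separators n p.2.1) t = countLE (separators n q.2.1) t := by
    intro t ht
    have h1 := blockFun_apply hk hkn p ⟨t, ht⟩
    have h2 := blockFun_apply hk hkn q ⟨t, ht⟩
    rw [← h1, ← h2, hpq, hw]
  have hB : separators n p.2.1 = separators n q.2.1 := by
    ext r
    by_cases hr : r ∈ Finset.Ico 1 n
    · obtain ⟨h1, h2⟩ := Finset.mem_Ico.1 hr
      obtain ⟨t, rfl⟩ : ∃ t, r = t + 1 := ⟨r - 1, by omega⟩
      have h3 := hc t (by omega)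
      have h4 := hc (t + 1) h2
      rw [countLE_succ, countLE_succ, h3] at h4
      by_cases h5 : t + 1 ∈ separators n p.2.1 <;> by_cases h6 : t + 1 ∈ separators n q.2.1 <;>
        simp [h5, h6] at h4 ⊢
    · simp only [separators, Finset.mem_sdiff, hr, false_and]
  have hS : p.2.1 = q.2.1 := by
    rw [← Finset.sdiff_sdiff_eq_self (p.subset.trans Finset.sdiff_subset),
      ← Finset.sdiff_sdiff_eq_self (q.subset.trans Finset.sdiff_subset)]
    exact congrArg (Finset.Ico 1 n \ ·) hB
  obtain ⟨w, S⟩ := p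
  obtain ⟨w', S'⟩ := q
  simp only at hw hS
  subst hw
  rw [Subtype.ext hS]

/-- The index type of the generalized Garsia–Stanton monomials. -/
abbrev GSIndex (n k : ℕ) : Type :=
  {p : Equiv.Perm (Fin n) × (ℕ → ℕ) // GScond n k p.1 p.2}

lemma GScond.lt {n k : ℕ} {w : Equiv.Perm (Fin n)} {i : ℕ → ℕ} (h : GScond n k w i) (t : ℕ) :
    i t < k - (permDes w).card := by
  obtain ⟨h1, h2, h3⟩ := h
  by_cases ht : t < n - k
  · have := h2 0 t (Nat.zero_le _) ht
    omega
  · have := h3 t (not_lt.1 ht)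
    omega

/-- The multiset of values of the sequence of an index of a Garsia–Stanton monomial. -/
def gsIndexToSym {n k : ℕ} (p : GSIndex n k) :
    Σ w : Equiv.Perm (Fin n), Sym (Fin (k - (permDes w).card)) (n - k) :=
  ⟨p.1.1, ⟨(Multiset.range (n - k)).map fun t => ⟨p.1.2 t, p.2.lt t⟩, by simp⟩⟩

lemma gsIndexToSym_injective {n k : ℕ} :
    Function.Injective (gsIndexToSym : GSIndex n k → _) := by
  rintro ⟨⟨w, i⟩, h⟩ ⟨⟨w', i'⟩, h'⟩ heq
  have hw : w = w' := congrArg Sigma.fst heq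
  subst hw
  have h1 := congrArg (fun s : Sym _ _ => s.1.map Fin.val) (eq_of_heq (Sigma.mk.inj heq).2)
  simp only [Multiset.map_map, Function.comp_def] at h1
  have hsorted : ∀ i : ℕ → ℕ, GScond n k w i →
      ((List.range (n - k)).map i).Pairwise (· ≥ ·) := by
    intro i hi
    rw [List.pairwise_map]
    exact List.pairwise_lt_range.imp_of_mem fun _ hb hab =>
      hi.2.1 _ _ hab.le (List.mem_range.1 hb)
  have hperm : ((List.range (n - k)).map i).Perm ((List.range (n - k)).map i') :=
    Multiset.coe_eq_coe.1 h1
  have hlist := hperm.eq_of_pairwise (fun _ _ _ _ h1 h2 => le_antisymm h2 h1)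
    (hsorted i h) (hsorted i' h')
  have hi : i = i' := by
    funext t
    by_cases ht : t < n - k
    · exact List.map_inj_left.1 hlist t (List.mem_range.2 ht)
    · exact (h.2.2 t (not_lt.1 ht)).trans (h'.2.2 t (not_lt.1 ht)).symm
  subst hi
  rfl

instance {n k : ℕ} : Finite (GSIndex n k) := Finite.of_injective _ gsIndexToSym_injective

/-- There are at most as many Garsia–Stanton monomials as surjections `[n] → [k]`. -/
theorem card_gsIndex_le {n k : ℕ} (hk : 1 ≤ k) (hkn : k ≤ n) :
    Nat.card (GSIndex n k) ≤ Nat.card {f : Fin n → Fin k // Function.Surjective f} := by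
  have h1 : Nat.card (AscentChoice n k) ≤
      Nat.card {f : Fin n → Fin k // Function.Surjective f} :=
    Nat.card_le_card_of_injective
      (fun p => ⟨blockFun hk hkn p, blockFun_surjective hk hkn p⟩)
      fun p q h => blockFun_injective hk hkn (Subtype.ext_iff.1 h)
  have h2 := Nat.card_le_card_of_injective _ (gsIndexToSym_injective (n := n) (k := k))
  refine h2.trans (le_trans ?_ h1)
  rw [Nat.card_eq_fintype_card, Nat.card_eq_fintype_card, Fintype.card_sigma, Fintype.card_sigma]
  refine Finset.sum_le_sum fun w _ => ?_
  have hdes : permDes w ⊆ Finset.Ico 1 n := Finset.filter_subset _ _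
  rw [Sym.card_sym_eq_multichoose, Fintype.card_fin, Nat.multichoose_eq, Fintype.card_coe,
    Finset.card_powersetCard, Finset.card_sdiff_of_subset hdes, Nat.card_Ico]
  have hle := Finset.card_le_card hdes
  rw [Nat.card_Ico] at hle
  by_cases hdk : (permDes w).card < k
  · exact Nat.choose_le_choose _ (by omega)
  · rcases Nat.eq_zero_or_pos (n - k) with h0 | h0
    · rw [h0]
      simp
    · rw [Nat.choose_eq_zero_of_lt (by omega)]
      exact Nat.zero_le _

section Points

variable {n k : ℕ}

/-- The index of the `i`-th coordinate of the point attached to `f : [n] → [k]`: it is `f i` if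
`i` is the first element of its fibre, and `k + j` if `j` is the preceding element of the fibre. -/
def pointIdx (f : Fin n → Fin k) (i : Fin n) : ℕ :=
  if h : (Finset.univ.filter fun j => j < i ∧ f j = f i).Nonempty then
    k + ((Finset.univ.filter fun j => j < i ∧ f j = f i).max' h : ℕ)
  else f i

lemma pointIdx_cases (f : Fin n → Fin k) (i : Fin n) :
    (pointIdx f i = f i ∧ ∀ j < i, f j ≠ f i) ∨
      ∃ j < i, f j = f i ∧ pointIdx f i = k + j ∧ ∀ l < i, f l = f i → l ≤ j := by
  unfold pointIdx
  split_ifs with h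
  · right
    have h1 := Finset.max'_mem _ h
    rw [Finset.mem_filter] at h1
    exact ⟨_, h1.2.1, h1.2.2, rfl, fun l hl hfl =>
      Finset.le_max' _ _ (Finset.mem_filter.2 ⟨Finset.mem_univ _, hl, hfl⟩)⟩
  · left
    refine ⟨rfl, fun j hj hfj => h ⟨j, ?_⟩⟩
    exact Finset.mem_filter.2 ⟨Finset.mem_univ _, hj, hfj⟩

lemma pointIdx_lt (f : Fin n → Fin k) (i : Fin n) : pointIdx f i < k + i := by
  rcases pointIdx_cases f i with ⟨h, _⟩ | ⟨j, hj, _, h, _⟩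
  · have := (f i).2
    omega
  · rw [Fin.lt_def] at hj
    omega

lemma pointIdx_injective (f : Fin n → Fin k) : Function.Injective (pointIdx f) := by
  have key : ∀ i i', i < i' → pointIdx f i ≠ pointIdx f i' := by
    intro i i' hlt heq
    rcases pointIdx_cases f i with ⟨h, h1⟩ | ⟨j, hj, h2, h, h3⟩ <;>
      rcases pointIdx_cases f i' with ⟨h', h1'⟩ | ⟨j', hj', h2', h', h3'⟩
    · exact h1' i hlt (Fin.ext (by omega))
    · have := (f i).2
      omega
    · have := (f i').2
      omega
    · have hjj : j = j' := Fin.ext (by omega)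
      subst hjj
      exact (h3' i hlt (h2.symm.trans h2')).not_gt hj
  intro i i' heq
  rcases lt_trichotomy i i' with h | h | h
  · exact absurd heq (key _ _ h)
  · exact h
  · exact absurd heq.symm (key _ _ h)

lemma exists_pointIdx_eq {f : Fin n → Fin k} (hf : Function.Surjective f) {v : ℕ} (hv : v < k) :
    ∃ i, pointIdx f i = v := by
  obtain ⟨i₀, hi₀⟩ := hf ⟨v, hv⟩
  obtain ⟨i, hi, hmin⟩ := Finset.exists_min_image
    (Finset.univ.filter fun i => f i = ⟨v, hv⟩) id ⟨i₀, by simpa using hi₀⟩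
  rw [Finset.mem_filter] at hi
  refine ⟨i, ?_⟩
  rcases pointIdx_cases f i with ⟨h, _⟩ | ⟨j, hj, h, _⟩
  · rw [h, hi.2]
  · have := hmin j (Finset.mem_filter.2 ⟨Finset.mem_univ _, h.trans hi.2⟩)
    exact absurd hj this.not_gt

lemma eq_of_pointIdx_eq {f g : Fin n → Fin k} (h : pointIdx f = pointIdx g) : f = g := by
  funext i
  induction i using WellFoundedLT.induction with
  | _ i ih =>
  have hi := congrFun h i
  rcases pointIdx_cases f i with ⟨h1, _⟩ | ⟨j, hj, h2, h1, _⟩ <;>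
    rcases pointIdx_cases g i with ⟨h1', _⟩ | ⟨j', hj', h2', h1', _⟩
  · exact Fin.ext (by omega)
  · have := (f i).2
    omega
  · have := (g i).2
    omega
  · have hjj : j = j' := Fin.ext (by omega)
    subst hjj
    rw [← h2, ← h2', ih j hj]

end Points

section GeneratingFunctions

variable {R : Type*} [CommRing R]

/-- The linear power series `1 - a z`. -/
def linSeries (a : R) : PowerSeries R := 1 - PowerSeries.C a * PowerSeries.X

/-- The geometric power series `Σ_d a^d z^d`. -/
def geomSeries (a : R) : PowerSeries R := PowerSeries.mk fun d => a ^ d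

lemma linSeries_mul_geomSeries (a : R) : linSeries a * geomSeries a = 1 := by
  ext d
  rw [linSeries, sub_mul, one_mul, map_sub, mul_assoc, PowerSeries.coeff_C_mul]
  cases d with
  | zero => simp [geomSeries]
  | succ d =>
    rw [PowerSeries.coeff_succ_X_mul]
    simp [geomSeries, PowerSeries.coeff_one, pow_succ']

lemma map_linSeries {S : Type*} [CommRing S] (φ : R →+* S) (a : R) :
    PowerSeries.map φ (linSeries a) = linSeries (φ a) := by
  simp [linSeries]

lemma map_geomSeries {S : Type*} [CommRing S] (φ : R →+* S) (a : R) :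
    PowerSeries.map φ (geomSeries a) = geomSeries (φ a) := by
  ext d
  simp [geomSeries]

lemma coeff_prod_linSeries_eq_zero {ι : Type*} (a : ι → R) (s : Finset ι) {d : ℕ}
    (hd : s.card < d) : PowerSeries.coeff d (∏ j ∈ s, linSeries (a j)) = 0 := by
  induction s using Finset.induction_on generalizing d with
  | empty =>
    rw [Finset.prod_empty, PowerSeries.coeff_one, if_neg (by simp at hd; omega)]
  | insert j s hj ih =>
    rw [Finset.card_insert_of_notMem hj] at hd
    obtain ⟨d, rfl⟩ : ∃ e, d = e + 1 := ⟨d - 1, by omega⟩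
    rw [Finset.prod_insert hj, linSeries, sub_mul, one_mul, map_sub, mul_assoc,
      PowerSeries.coeff_C_mul, PowerSeries.coeff_succ_X_mul, ih (by omega), ih (by omega)]
    simp

lemma coeff_prod_linSeries_mul_prod_geomSeries_eq_zero {ι : Type*} (a : ι → R) {s t : Finset ι}
    (hst : s ⊆ t) {d : ℕ} (hd : t.card < s.card + d) :
    PowerSeries.coeff d ((∏ j ∈ t, linSeries (a j)) * ∏ j ∈ s, geomSeries (a j)) = 0 := by
  rw [← Finset.prod_sdiff hst, mul_assoc, ← Finset.prod_mul_distrib]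
  simp only [linSeries_mul_geomSeries, Finset.prod_const_one, mul_one]
  apply coeff_prod_linSeries_eq_zero
  rw [Finset.card_sdiff_of_subset hst]
  have := Finset.card_le_card hst
  omega

lemma coeff_prod_geomSeries_X (n d m : ℕ) :
    PowerSeries.coeff d (∏ i ∈ Finset.univ.filter (fun i : Fin n => (i : ℕ) < m),
      geomSeries (X i : MvPolynomial (Fin n) R)) = homogSum R n d m := by
  rw [PowerSeries.coeff_prod, homogSum]
  refine Finset.sum_congr rfl fun a ha => ?_
  rw [Finset.mem_finsuppAntidiag] at ha
  rw [monomial_eq, C_1, one_mul, Finsupp.prod_of_support_subset _ ha.2 _ (by simp)]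
  simp [geomSeries]

lemma coeff_prod_linSeries_neg_X (n d : ℕ) :
    PowerSeries.coeff d (∏ i, linSeries (-X i : MvPolynomial (Fin n) R)) =
      esymm (Fin n) R d := by
  have h : ∀ i : Fin n, linSeries (-X i : MvPolynomial (Fin n) R) =
      1 + PowerSeries.C (X i) * PowerSeries.X := by
    intro i
    simp [linSeries]
  simp only [h]
  rw [Finset.prod_one_add, map_sum, esymm, Finset.powersetCard_eq_filter, Finset.sum_filter]
  refine Finset.sum_congr rfl fun t _ => ?_
  rw [Finset.prod_mul_distrib, ← map_prod, Finset.prod_const, PowerSeries.coeff_C_mul,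
    PowerSeries.coeff_X_pow]
  split_ifs with h1 h2 h2
  · simp
  · exact absurd h1.symm h2
  · exact absurd h2.symm h1
  · simp

lemma totalDegree_homogSum_le (n d m : ℕ) : (homogSum R n d m).totalDegree ≤ d := by
  refine totalDegree_finsetSum_le fun a ha => (totalDegree_monomial_le _ _).trans ?_
  rw [Finset.mem_finsuppAntidiag] at ha
  rw [Finsupp.sum_of_support_subset _ ha.2 _ (by simp)]
  exact ha.1.le

lemma totalDegree_esymm_le (n d : ℕ) : (esymm (Fin n) R d).totalDegree ≤ d := by
  rw [esymm_eq_sum_monomial]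
  refine totalDegree_finsetSum_le fun t ht => (totalDegree_monomial_le _ _).trans ?_
  have := degree_indicatorExp t
  rw [(Finset.mem_powersetCard.1 ht).2] at this
  exact this.le

lemma exists_coeff_map_C_mul {n : ℕ} (B : PowerSeries R) (hB : PowerSeries.coeff 0 B = 1)
    (Q : PowerSeries (MvPolynomial (Fin n) R))
    (hQ : ∀ q, (PowerSeries.coeff q Q).totalDegree ≤ q) {d : ℕ} (hd : 1 ≤ d) :
    ∃ p : MvPolynomial (Fin n) R, p.totalDegree < d ∧
      PowerSeries.coeff d (PowerSeries.map C B * Q) = PowerSeries.coeff d Q + p := by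
  obtain ⟨d, rfl⟩ : ∃ e, d = e + 1 := ⟨d - 1, by omega⟩
  refine ⟨∑ x ∈ Finset.HasAntidiagonal.antidiagonal d,
    C (PowerSeries.coeff (x.1 + 1) B) * PowerSeries.coeff x.2 Q, ?_, ?_⟩
  · refine Nat.lt_succ_of_le (totalDegree_finsetSum_le fun x hx => ?_)
    have h1 := totalDegree_mul (C (PowerSeries.coeff (x.1 + 1) B)) (PowerSeries.coeff x.2 Q)
    have h2 := hQ x.2
    have h3 := Finset.HasAntidiagonal.mem_antidiagonal.1 hx
    rw [totalDegree_C] at h1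
    omega
  · rw [PowerSeries.coeff_mul, Finset.Nat.sum_antidiagonal_succ]
    simp [hB]

lemma coeff_zero_prod_linSeries {ι : Type*} (a : ι → R) (s : Finset ι) :
    PowerSeries.coeff 0 (∏ j ∈ s, linSeries (a j)) = 1 := by
  rw [PowerSeries.coeff_zero_eq_constantCoeff_apply, map_prod]
  simp [linSeries]

lemma coeff_zero_prod_geomSeries {ι : Type*} (a : ι → R) (s : Finset ι) :
    PowerSeries.coeff 0 (∏ j ∈ s, geomSeries (a j)) = 1 := by
  rw [PowerSeries.coeff_zero_eq_constantCoeff_apply, map_prod]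
  simp [geomSeries, ← PowerSeries.coeff_zero_eq_constantCoeff_apply]

/-- A deformation of the complete homogeneous symmetric polynomial `h_k(x_1, …, x_m)`. -/
def homogDeform (n k : ℕ) (α : ℕ → R) (m : ℕ) : MvPolynomial (Fin n) R :=
  PowerSeries.coeff k (PowerSeries.map C (∏ j ∈ Finset.range (k + m - 1), linSeries (α j)) *
    ∏ i ∈ Finset.univ.filter (fun i : Fin n => (i : ℕ) < m), geomSeries (X i))

/-- A deformation of the elementary symmetric polynomial `e_d(x_1, …, x_n)`. -/
def elemDeform (n k : ℕ) (α : ℕ → R) (d : ℕ) : MvPolynomial (Fin n) R :=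
  PowerSeries.coeff d (PowerSeries.map C (∏ j ∈ Finset.range k, geomSeries (-α j)) *
    ∏ i, linSeries (-X i))

lemma exists_homogDeform_eq (n : ℕ) {k : ℕ} (hk : 1 ≤ k) (α : ℕ → R) (m : ℕ) :
    ∃ p : MvPolynomial (Fin n) R, p.totalDegree < k ∧
      homogDeform n k α m = homogSum R n k m + p := by
  rw [← coeff_prod_geomSeries_X]
  refine exists_coeff_map_C_mul _ (coeff_zero_prod_linSeries _ _) _ (fun q => ?_) hk
  rw [coeff_prod_geomSeries_X]
  exact totalDegree_homogSum_le _ _ _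

lemma exists_elemDeform_eq (n k : ℕ) (α : ℕ → R) {d : ℕ} (hd : 1 ≤ d) :
    ∃ p : MvPolynomial (Fin n) R, p.totalDegree < d ∧
      elemDeform n k α d = esymm (Fin n) R d + p := by
  rw [← coeff_prod_linSeries_neg_X]
  refine exists_coeff_map_C_mul _ (coeff_zero_prod_geomSeries _ _) _ (fun q => ?_) hd
  rw [coeff_prod_linSeries_neg_X]
  exact totalDegree_esymm_le _ _

lemma map_comp_C {n : ℕ} {S : Type*} [CommRing S] (φ : MvPolynomial (Fin n) R →+* S)
    (B : PowerSeries R) :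
    PowerSeries.map φ (PowerSeries.map C B) = PowerSeries.map (φ.comp C) B := by
  ext d
  simp

lemma map_homogDeform {S : Type*} [CommRing S] (φ : R →+* S) (n k : ℕ) (α : ℕ → R)
    (hα : ∀ j, φ (α j) = 0) (m : ℕ) : map φ (homogDeform n k α m) = homogSum S n k m := by
  rw [homogDeform, ← PowerSeries.coeff_map, map_mul, map_comp_C, map_prod, map_prod,
    ← coeff_prod_geomSeries_X]
  simp [map_geomSeries, hα, linSeries]

lemma map_elemDeform {S : Type*} [CommRing S] (φ : R →+* S) (n k : ℕ) (α : ℕ → R)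
    (hα : ∀ j, φ (α j) = 0) (d : ℕ) : map φ (elemDeform n k α d) = esymm (Fin n) S d := by
  have h0 : geomSeries (0 : MvPolynomial (Fin n) S) = 1 := by
    ext d
    simp [geomSeries, PowerSeries.coeff_one, zero_pow_eq]
  rw [elemDeform, ← PowerSeries.coeff_map, map_mul, map_comp_C, map_prod, map_prod,
    ← coeff_prod_linSeries_neg_X]
  simp [map_linSeries, map_geomSeries, hα, h0]

/-- The point attached to a function `f : [n] → [k]`. -/
def point {n k : ℕ} (α : ℕ → R) (f : Fin n → Fin k) (i : Fin n) : R := α (pointIdx f i)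

lemma eval_homogDeform {n k : ℕ} (hk : 1 ≤ k) (α : ℕ → R) (f : Fin n → Fin k) {m : ℕ}
    (hm : 1 ≤ m) (hmn : m ≤ n) : eval (point α f) (homogDeform n k α m) = 0 := by
  rw [homogDeform, ← PowerSeries.coeff_map, map_mul, map_comp_C, map_prod, map_prod]
  have hC : (eval (point α f)).comp C = RingHom.id R := by
    ext r
    simp
  simp only [map_linSeries, map_geomSeries, hC, RingHom.id_apply, eval_X, point]
  rw [← Finset.prod_image (s := Finset.univ.filter fun i : Fin n => (i : ℕ) < m)
    (g := pointIdx f) (f := fun j => geomSeries (α j)) (pointIdx_injective f).injOn]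
  apply coeff_prod_linSeries_mul_prod_geomSeries_eq_zero
  · intro v hv
    rw [Finset.mem_image] at hv
    obtain ⟨i, hi, rfl⟩ := hv
    have h1 := (Finset.mem_filter.1 hi).2
    have h2 := pointIdx_lt f i
    rw [Finset.mem_range]
    omega
  · rw [Finset.card_image_of_injective _ (pointIdx_injective f), Fin.card_filter_val_lt,
      min_eq_right hmn, Finset.card_range]
    omega

lemma eval_elemDeform {n k : ℕ} (α : ℕ → R) {f : Fin n → Fin k} (hf : Function.Surjective f)
    {d : ℕ} (hd : n - k < d) : eval (point α f) (elemDeform n k α d) = 0 := by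
  rw [elemDeform, ← PowerSeries.coeff_map, map_mul, map_comp_C, map_prod, map_prod]
  have hC : (eval (point α f)).comp C = RingHom.id R := by
    ext r
    simp
  simp only [map_linSeries, map_geomSeries, hC, RingHom.id_apply, eval_X, map_neg, point]
  rw [← Finset.prod_image (s := Finset.univ) (g := pointIdx f) (f := fun j => linSeries (-α j))
    (pointIdx_injective f).injOn, mul_comm]
  apply coeff_prod_linSeries_mul_prod_geomSeries_eq_zero (fun j => -α j)
  · intro v hv
    obtain ⟨i, hi⟩ := exists_pointIdx_eq hf (Finset.mem_range.1 hv)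
    exact Finset.mem_image.2 ⟨i, Finset.mem_univ _, hi⟩
  · rw [Finset.card_image_of_injective _ (pointIdx_injective f), Finset.card_univ,
      Fintype.card_fin, Finset.card_range]
    omega

end GeneratingFunctions

section Independence

variable {R : Type*} [CommRing R] {n k : ℕ}

instance : Fintype (GSIndex n k) := Fintype.ofFinite _

/-- The generalized Garsia–Stanton monomials over a commutative ring. -/
def gsMonomial (R : Type*) [CommRing R] {n k : ℕ} (p : GSIndex n k) : MvPolynomial (Fin n) R :=
  monomial (Finsupp.equivFunOnFinite.symm (gsExp p.1.1 p.1.2)) 1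

lemma gsSpan_eq (R : Type*) [CommRing R] (n k : ℕ) :
    gsSpan R n k = Submodule.span R (Set.range (gsMonomial R : GSIndex n k → _)) := rfl

lemma gsMono_eq (F : Type*) [Field F] (p : GSIndex n k) :
    gsMono F n p.1.1 p.1.2 = gsMonomial F p := by
  rw [gsMonomial, monomial_eq, C_1, one_mul, Finsupp.prod_fintype _ _ (by simp)]
  rfl

/-- The ideal of polynomials vanishing at the points attached to the surjections `[n] → [k]`. -/
def pointIdeal (n k : ℕ) (α : ℕ → R) : Ideal (MvPolynomial (Fin n) R) :=
  ⨅ f : {f : Fin n → Fin k // Function.Surjective f}, RingHom.ker (eval (point α f.1))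

lemma mem_pointIdeal {α : ℕ → R} {g : MvPolynomial (Fin n) R} :
    g ∈ pointIdeal n k α ↔
      ∀ f : {f : Fin n → Fin k // Function.Surjective f}, eval (point α f.1) g = 0 := by
  simp only [pointIdeal, Submodule.mem_iInf, RingHom.mem_ker]

lemma homogDeform_mem_pointIdeal (hk : 1 ≤ k) (α : ℕ → R) {m : ℕ} (hm : 1 ≤ m) (hmn : m ≤ n) :
    homogDeform n k α m ∈ pointIdeal n k α :=
  mem_pointIdeal.2 fun f => eval_homogDeform hk α f.1 hm hmn

lemma elemDeform_mem_pointIdeal (α : ℕ → R) {d : ℕ} (hd : n - k < d) :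
    elemDeform n k α d ∈ pointIdeal n k α :=
  mem_pointIdeal.2 fun f => eval_elemDeform α f.2 hd

lemma hasLeadingForms_pointIdeal (hk : 1 ≤ k) (α : ℕ → R) :
    HasLeadingForms n k (pointIdeal n k α) where
  homog m hm hmn := by
    obtain ⟨p, hp, h⟩ := exists_homogDeform_eq n hk α m
    exact ⟨p, hp, h ▸ homogDeform_mem_pointIdeal hk α hm hmn⟩
  elem d hd _ := by
    obtain ⟨p, hp, h⟩ := exists_elemDeform_eq n k α (d := d) (by omega)
    exact ⟨p, hp, h ▸ elemDeform_mem_pointIdeal α hd⟩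

lemma exists_eval_ne_zero_and_eq_zero [IsDomain R] {α : ℕ → R} (hα : Function.Injective α)
    (f₀ : Fin n → Fin k) :
    ∃ g : MvPolynomial (Fin n) R, eval (point α f₀) g ≠ 0 ∧
      ∀ f, f ≠ f₀ → eval (point α f) g = 0 := by
  have h : ∀ f : Fin n → Fin k, ∃ g : MvPolynomial (Fin n) R,
      eval (point α f₀) g ≠ 0 ∧ (f ≠ f₀ → eval (point α f) g = 0) := by
    intro f
    by_cases hf : f = f₀
    · exact ⟨1, by simp, fun h => absurd hf h⟩
    · obtain ⟨i, hi⟩ := Function.ne_iff.1 fun h => hf (eq_of_pointIdx_eq h)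
      refine ⟨X i - C (point α f i), ?_, fun _ => by simp⟩
      rw [map_sub, eval_X, eval_C, sub_ne_zero]
      exact fun h => hi (hα h).symm
  choose g hg0 hg using h
  refine ⟨∏ f, g f, ?_, fun f hf => ?_⟩
  · rw [map_prod]
    exact Finset.prod_ne_zero_iff.2 fun f _ => hg0 f
  · rw [map_prod]
    exact Finset.prod_eq_zero (Finset.mem_univ f) (hg f hf)

/-- The evaluations of the Garsia–Stanton monomials at the points attached to the surjections
`[n] → [k]` are linearly independent. -/
theorem eq_zero_of_sum_mem_pointIdeal [IsDomain R] (hk : 1 ≤ k) (hkn : k ≤ n) {α : ℕ → R}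
    (hα : Function.Injective α) (c : GSIndex n k → R)
    (hc : ∑ p, c p • gsMonomial R p ∈ pointIdeal n k α) (p : GSIndex n k) : c p = 0 := by
  let K := FractionRing R
  let S := {f : Fin n → Fin k // Function.Surjective f}
  let E : MvPolynomial (Fin n) R →ₗ[R] (S → K) :=
    LinearMap.pi fun f => (Algebra.linearMap R K).comp (aeval (point α f.1)).toLinearMap
  have hE : ∀ g f, E g f = algebraMap R K (eval (point α f.1) g) := by
    intro g f
    simp [E, aeval_eq_eval]
  let v : GSIndex n k → S → K := fun p => E (gsMonomial R p)
  have hmem : ∀ g, E g ∈ Submodule.span K (Set.range v) := by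
    intro g
    have hg : g ∈ gsSpan R n k ⊔ (pointIdeal n k α).restrictScalars R := by
      rw [gsSpan_sup_eq_top hk hkn (hasLeadingForms_pointIdeal hk α)]
      trivial
    obtain ⟨y, hy, z, hz, rfl⟩ := Submodule.mem_sup.1 hg
    have hz0 : E z = 0 := by
      ext f
      rw [hE, mem_pointIdeal.1 hz f, map_zero, Pi.zero_apply]
    rw [map_add, hz0, add_zero]
    have hle : gsSpan R n k ≤ ((Submodule.span K (Set.range v)).restrictScalars R).comap E := by
      rw [gsSpan_eq, Submodule.span_le]
      rintro _ ⟨q, rfl⟩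
      exact Submodule.subset_span ⟨q, rfl⟩
    exact hle hy
  have hspan : ⊤ ≤ Submodule.span K (Set.range v) := by
    intro x _
    rw [pi_eq_sum_univ' x]
    refine Submodule.sum_mem _ fun f₀ _ => Submodule.smul_mem _ _ ?_
    obtain ⟨g, hg0, hg⟩ := exists_eval_ne_zero_and_eq_zero hα f₀.1
    have hne : algebraMap R K (eval (point α f₀.1) g) ≠ 0 := by
      rwa [Ne, FaithfulSMul.algebraMap_eq_zero_iff]
    convert Submodule.smul_mem _ (algebraMap R K (eval (point α f₀.1) g))⁻¹ (hmem g) using 1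
    ext f
    rw [Pi.smul_apply, hE, smul_eq_mul]
    by_cases hf : f = f₀
    · subst hf
      rw [inv_mul_cancel₀ hne]
      simp
    · rw [hg f.1 fun h => hf (Subtype.ext h)]
      simp [Ne.symm hf]
  have hli : LinearIndependent K v := by
    refine linearIndependent_of_top_le_span_of_card_le_finrank hspan ?_
    have := card_gsIndex_le hk hkn
    rwa [Module.finrank_fintype_fun_eq_card, ← Nat.card_eq_fintype_card, ← Nat.card_eq_fintype_card]
  have h0 : ∑ q, algebraMap R K (c q) • v q = 0 := by
    have h1 : E (∑ q, c q • gsMonomial R q) = 0 := by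
      ext f
      rw [hE, mem_pointIdeal.1 hc f, map_zero, Pi.zero_apply]
    rw [map_sum] at h1
    simpa only [map_smul, algebraMap_smul] using h1
  have := Fintype.linearIndependent_iff.1 hli _ h0 p
  rwa [FaithfulSMul.algebraMap_eq_zero_iff] at this

end Independence

section Field

variable {F : Type*} [Field F] {n k : ℕ}

lemma hasLeadingForms_Jideal (hk : 1 ≤ k) : HasLeadingForms n k (Jideal F n k) where
  homog m hm hmn := by
    refine ⟨0, by rw [totalDegree_zero]; omega, ?_⟩
    rw [add_zero, ← hpoly_eq_homogSum]
    exact Ideal.subset_span (Or.inl ⟨m, hm, hmn, rfl⟩)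
  elem d hd hdn := by
    refine ⟨0, by rw [totalDegree_zero]; omega, ?_⟩
    rw [add_zero]
    exact Ideal.subset_span (Or.inr ⟨d, hd, hdn, rfl⟩)

/-- The sequence `t, t², t³, …` of polynomials in `t`. -/
def powSeq (F : Type*) [Field F] (j : ℕ) : Polynomial F := Polynomial.X ^ (j + 1)

lemma powSeq_injective : Function.Injective (powSeq F) := by
  intro i j h
  have := congrArg Polynomial.natDegree h
  simpa [powSeq] using this

lemma evalRingHom_powSeq (j : ℕ) : Polynomial.evalRingHom (0 : F) (powSeq F j) = 0 := by
  simp [powSeq]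

lemma Jideal_le_map_pointIdeal (hk : 1 ≤ k) :
    Jideal F n k ≤ (pointIdeal n k (powSeq F)).map (map (Polynomial.evalRingHom (0 : F))) := by
  rw [Jideal, Ideal.span_le]
  rintro _ (⟨m, hm, hmn, rfl⟩ | ⟨d, hd, -, rfl⟩)
  · rw [hpoly_eq_homogSum, ← map_homogDeform _ n k _ evalRingHom_powSeq]
    exact Ideal.mem_map_of_mem _ (homogDeform_mem_pointIdeal hk _ hm hmn)
  · rw [← map_elemDeform _ n k _ evalRingHom_powSeq]
    exact Ideal.mem_map_of_mem _ (elemDeform_mem_pointIdeal _ hd)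

lemma C_X_dvd_of_map_eq_zero {g : MvPolynomial (Fin n) (Polynomial F)}
    (hg : map (Polynomial.evalRingHom (0 : F)) g = 0) : C Polynomial.X ∣ g := by
  rw [C_dvd_iff_dvd_coeff]
  intro m
  rw [Polynomial.X_dvd_iff, Polynomial.coeff_zero_eq_eval_zero]
  have := congrArg (coeff m) hg
  rwa [coeff_map] at this

theorem eq_zero_of_sum_mem_Jideal (hk : 1 ≤ k) (hkn : k ≤ n) (c : GSIndex n k → F)
    (hc : ∑ p, c p • gsMonomial F p ∈ Jideal F n k) (p : GSIndex n k) : c p = 0 := by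
  have hsurj : Function.Surjective (map (σ := Fin n) (Polynomial.evalRingHom (0 : F))) :=
    map_surjective _ fun a => ⟨Polynomial.C a, by simp⟩
  obtain ⟨g, hg, hgc⟩ :=
    (Ideal.mem_map_iff_of_surjective _ hsurj).1 (Jideal_le_map_pointIdeal hk hc)
  let s : MvPolynomial (Fin n) (Polynomial F) :=
    ∑ p : GSIndex n k, Polynomial.C (c p) • gsMonomial (Polynomial F) p
  obtain ⟨q, hq⟩ := C_X_dvd_of_map_eq_zero (g := g - s) (by
    rw [map_sub, hgc, sub_eq_zero, map_sum]
    refine Finset.sum_congr rfl fun p _ => ?_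
    simp [gsMonomial, smul_monomial])
  have hqt : q ∈ gsSpan (Polynomial F) n k ⊔
      (pointIdeal n k (powSeq F)).restrictScalars (Polynomial F) := by
    rw [gsSpan_sup_eq_top hk hkn (hasLeadingForms_pointIdeal hk _)]
    trivial
  obtain ⟨y, hy, z, hz, rfl⟩ := Submodule.mem_sup.1 hqt
  rw [gsSpan_eq, Submodule.mem_span_range_iff_exists_fun] at hy
  obtain ⟨c', rfl⟩ := hy
  have hmem : ∑ p, (Polynomial.C (c p) + Polynomial.X * c' p) • gsMonomial (Polynomial F) p ∈
      pointIdeal n k (powSeq F) := by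
    have h : ∑ p, (Polynomial.C (c p) + Polynomial.X * c' p) • gsMonomial (Polynomial F) p =
        g - C Polynomial.X * z := by
      simp only [add_smul, mul_smul, Finset.sum_add_distrib, ← Finset.smul_sum]
      rw [smul_eq_C_mul _ Polynomial.X]
      linear_combination -hq
    rw [h]
    exact sub_mem hg (Ideal.mul_mem_left _ _ hz)
  have h0 := eq_zero_of_sum_mem_pointIdeal hk hkn powSeq_injective _ hmem p
  simpa using congrArg (Polynomial.eval 0) h0

end Field

/-- The set `GS_{n,k}` of generalized Garsia–Stanton monomials
descends to an `F`-basis of `S_{n,k} = F[x_1,…,x_n]/J_{n,k}`. -/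
theorem garsia_stanton_basis (F : Type*) [Field F] (n k : ℕ) (hk : 1 ≤ k) (hkn : k ≤ n) :
    LinearIndependent F
      (fun p : {p : Equiv.Perm (Fin n) × (ℕ → ℕ) // GScond n k p.1 p.2} =>
        Ideal.Quotient.mk (Jideal F n k) (gsMono F n p.1.1 p.1.2)) ∧
    Submodule.span F
      (Set.range
        (fun p : {p : Equiv.Perm (Fin n) × (ℕ → ℕ) // GScond n k p.1 p.2} =>
          Ideal.Quotient.mk (Jideal F n k) (gsMono F n p.1.1 p.1.2))) = ⊤ := by
  have hfun : (fun p : GSIndex n k =>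
      Ideal.Quotient.mk (Jideal F n k) (gsMono F n p.1.1 p.1.2)) =
      Ideal.Quotient.mkₐ F (Jideal F n k) ∘ gsMonomial F := by
    funext p
    rw [gsMono_eq]
    rfl
  rw [hfun]
  constructor
  · rw [Fintype.linearIndependent_iff]
    intro c hc
    apply eq_zero_of_sum_mem_Jideal hk hkn
    rw [← Ideal.Quotient.eq_zero_iff_mem, ← Ideal.Quotient.mkₐ_eq_mk F, map_sum]
    simpa only [map_smul, Function.comp_apply] using hc
  · rw [eq_top_iff]
    intro x _
    obtain ⟨g, rfl⟩ := Ideal.Quotient.mkₐ_surjective F (Jideal F n k) x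
    have hg : g ∈ gsSpan F n k ⊔ (Jideal F n k).restrictScalars F := by
      rw [gsSpan_sup_eq_top hk hkn (hasLeadingForms_Jideal hk)]
      trivial
    obtain ⟨y, hy, z, hz, rfl⟩ := Submodule.mem_sup.1 hg
    rw [map_add, Ideal.Quotient.mkₐ_eq_mk F, Ideal.Quotient.eq_zero_iff_mem.2 hz, add_zero,
      Set.range_comp, ← Ideal.Quotient.mkₐ_eq_mk F]
    have := Submodule.mem_map_of_mem (f := (Ideal.Quotient.mkₐ F (Jideal F n k)).toLinearMap) hy
    rwa [gsSpan_eq, Submodule.map_span] at this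

end OSPHecke
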